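/- Let N be a commutative, finitely generated, semipositive binoid and 𝔫 an N₊-primary ideal of N. Then the quotient binoid N/𝔫 (Rees quotient) is a finite set. -/

import Mathlib

/-!  Basic theory of (commutative) binoids: a commutative monoid together with
an absorbing element `infty`.  We use a bundled structure `BinoidOn X`. -/

structure BinoidOn (X : Type u) where
  add : X → X → X
  zero : X
  infty : X
  add_assoc : ∀ a b c : X, add (add a b) c = add a (add b c)
  add_comm : ∀ a b : X, add a b = add b a
  zero_add : ∀ a : X, add zero a = a
  infty_add : ∀ a : X, add infty a = infty

namespace BinoidOn

variable {X : Type u} {Y : Type v} (B : BinoidOn X) (C : BinoidOn Y)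

/-- `n`-fold multiple `n • a`. -/
def smul (B : BinoidOn X) : ℕ → X → X
  | 0, _ => B.zero
  | n + 1, a => B.add a (smul B n a)

/-- Sum of a list of elements. -/
def listSum (l : List X) : X := l.foldr B.add B.zero

/-- An ideal of a binoid: a nonempty subset `I` with `I + N ⊆ I`. -/
def IsIdeal (I : Set X) : Prop := I.Nonempty ∧ ∀ a ∈ I, ∀ x : X, B.add a x ∈ I

/-- A subbinoid: a submonoid containing `infty`. -/
def IsSubbinoid (M : Set X) : Prop :=
  B.zero ∈ M ∧ B.infty ∈ M ∧ ∀ a ∈ M, ∀ b ∈ M, B.add a b ∈ M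

/-- The set of units. -/
def unitsSet : Set X := {u | ∃ a, B.add u a = B.zero}

/-- `N₊`, the ideal of non-units. -/
def nplus : Set X := (B.unitsSet)ᶜ

/-- The ideal generated by a set. -/
def genIdeal (S : Set X) : Set X := {x | ∃ a ∈ S, ∃ n, x = B.add a n}

/-- The `n`-fold sum `nI = {a₁ + ⋯ + aₙ | aᵢ ∈ I}`. -/
def nSum (n : ℕ) (I : Set X) : Set X :=
  {x | ∃ l : List X, l.length = n ∧ (∀ a ∈ l, a ∈ I) ∧ x = B.listSum l}

/-- The Frobenius power `[q]I`: the ideal generated by `{q • a | a ∈ I}`. -/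
def frob (q : ℕ) (I : Set X) : Set X := B.genIdeal {x | ∃ a ∈ I, x = B.smul q a}

/-- The radical of an ideal. -/
def radical (I : Set X) : Set X := {a | ∃ n : ℕ, 0 < n ∧ B.smul n a ∈ I}

/-- `N₊`-primary ideal. -/
def IsPrimary (I : Set X) : Prop := B.radical I = B.nplus

/-- Finitely generated binoid. -/
def FG : Prop :=
  ∃ G : Finset X, ∀ x : X, x = B.infty ∨ ∃ l : List X, (∀ a ∈ l, a ∈ G) ∧ x = B.listSum l

/-- Semipositive: a nonzero binoid with finitely many units. -/
def Semipositive : Prop := B.zero ≠ B.infty ∧ B.unitsSet.Finite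

/-- Prime ideal. -/
def IsPrime (P : Set X) : Prop :=
  B.IsIdeal P ∧ P ≠ Set.univ ∧ ∀ a b : X, B.add a b ∈ P → a ∈ P ∨ b ∈ P

/-- The (combinatorial) dimension of the binoid is `d`: there is a strictly
increasing chain of prime ideals of length `d`, and no longer one. -/
def HasDim (d : ℕ) : Prop :=
  (∃ c : Fin (d + 1) → Set X, StrictMono c ∧ ∀ i, B.IsPrime (c i)) ∧
    ∀ (k : ℕ) (c : Fin (k + 1) → Set X), StrictMono c → (∀ i, B.IsPrime (c i)) → k ≤ d

end BinoidOn

/-- The setoid collapsing a subset `A` to a single point (Rees congruence). -/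
def collapseSetoid {X : Type u} (A : Set X) : Setoid X where
  r x y := x = y ∨ (x ∈ A ∧ y ∈ A)
  iseqv := ⟨fun _ => Or.inl rfl,
    fun h => h.elim (fun e => Or.inl e.symm) (fun h => Or.inr ⟨h.2, h.1⟩),
    fun h1 h2 => by
      rcases h1 with rfl | h1
      · exact h2
      · rcases h2 with rfl | h2
        · exact Or.inr h1
        · exact Or.inr ⟨h1.1, h2.2⟩⟩

namespace BinoidOn

variable {X : Type u} {Y : Type v} (B : BinoidOn X) (C : BinoidOn Y)

/-- The underlying set of the Rees quotient `N/I` (we collapse the ideal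
generated by `I`; for an ideal `I` this is `I` itself). -/
abbrev ReesQuot (I : Set X) : Type u := Quotient (collapseSetoid (B.genIdeal I))

lemma genIdeal_closed {I : Set X} {a : X} (ha : a ∈ B.genIdeal I) (x : X) :
    B.add a x ∈ B.genIdeal I := by
  obtain ⟨b, hb, n, rfl⟩ := ha
  exact ⟨b, hb, B.add n x, (B.add_assoc b n x)⟩

/-- The Rees quotient binoid `N/I`. -/
def quotB (I : Set X) : BinoidOn (B.ReesQuot I) where
  add := Quotient.map₂ B.add (by
    rintro a a' (rfl | ⟨ha, ha'⟩) b b' (rfl | ⟨hb, hb'⟩)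
    · exact Or.inl rfl
    · exact Or.inr ⟨by rw [B.add_comm]; exact B.genIdeal_closed hb _,
        by rw [B.add_comm]; exact B.genIdeal_closed hb' _⟩
    · exact Or.inr ⟨B.genIdeal_closed ha _, B.genIdeal_closed ha' _⟩
    · exact Or.inr ⟨B.genIdeal_closed ha _, B.genIdeal_closed ha' _⟩)
  zero := Quotient.mk _ B.zero
  infty := Quotient.mk _ B.infty
  add_assoc := by
    rintro ⟨a⟩ ⟨b⟩ ⟨c⟩
    exact congrArg (Quotient.mk _) (B.add_assoc a b c)
  add_comm := by
    rintro ⟨a⟩ ⟨b⟩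
    exact congrArg (Quotient.mk _) (B.add_comm a b)
  zero_add := by
    rintro ⟨a⟩
    exact congrArg (Quotient.mk _) (B.zero_add a)
  infty_add := by
    rintro ⟨a⟩
    exact congrArg (Quotient.mk _) (B.infty_add a)

/-- The underlying set of `N/[q]N₊`. -/
abbrev hkQuot (q : ℕ) : Type u := Quotient (collapseSetoid (B.frob q B.nplus))

/-- The Hilbert–Kunz function `HKF(N,q) = #(N/[q]N₊)`, where `#S = |S| - 1`. -/
noncomputable def hkf (q : ℕ) : ℕ := Nat.card (B.hkQuot q) - 1

/-- Pairs with an `infty` coordinate. -/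
def inftyPairs : Set (X × Y) := {p | p.1 = B.infty ∨ p.2 = C.infty}

/-- Carrier of the smash product `M ∧ N`. -/
abbrev SmashCarrier : Type _ := Quotient (collapseSetoid (B.inftyPairs C))

lemma inftyPairs_add_left {p q : X × Y} (hp : p ∈ B.inftyPairs C) :
    (B.add p.1 q.1, C.add p.2 q.2) ∈ B.inftyPairs C := by
  rcases hp with h | h
  · exact Or.inl (by rw [h, B.infty_add])
  · exact Or.inr (by rw [h, C.infty_add])

lemma inftyPairs_add_right {p q : X × Y} (hq : q ∈ B.inftyPairs C) :
    (B.add p.1 q.1, C.add p.2 q.2) ∈ B.inftyPairs C := by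
  rcases hq with h | h
  · exact Or.inl (by rw [h, B.add_comm, B.infty_add])
  · exact Or.inr (by rw [h, C.add_comm, C.infty_add])

/-- The smash product binoid `M ∧ N`. -/
def smash : BinoidOn (B.SmashCarrier C) where
  add := Quotient.map₂ (fun p q => (B.add p.1 q.1, C.add p.2 q.2)) (by
    rintro p p' (rfl | ⟨hp, hp'⟩) q q' (rfl | ⟨hq, hq'⟩)
    · exact Or.inl rfl
    · exact Or.inr ⟨B.inftyPairs_add_right C hq, B.inftyPairs_add_right C hq'⟩
    · exact Or.inr ⟨B.inftyPairs_add_left C hp, B.inftyPairs_add_left C hp'⟩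
    · exact Or.inr ⟨B.inftyPairs_add_left C hp, B.inftyPairs_add_left C hp'⟩)
  zero := Quotient.mk _ (B.zero, C.zero)
  infty := Quotient.mk _ (B.infty, C.infty)
  add_assoc := by
    rintro ⟨a⟩ ⟨b⟩ ⟨c⟩
    exact congrArg (Quotient.mk _)
      (Prod.ext (B.add_assoc _ _ _) (C.add_assoc _ _ _))
  add_comm := by
    rintro ⟨a⟩ ⟨b⟩
    exact congrArg (Quotient.mk _)
      (Prod.ext (B.add_comm _ _) (C.add_comm _ _))
  zero_add := by
    rintro ⟨a⟩
    exact congrArg (Quotient.mk _)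
      (Prod.ext (B.zero_add _) (C.zero_add _))
  infty_add := by
    rintro ⟨a⟩
    exact congrArg (Quotient.mk _)
      (Prod.ext (B.infty_add _) (C.infty_add _))

end BinoidOn

/-- An `N`-set: a pointed set with an operation of the binoid. -/
structure NSetOn {X : Type u} (B : BinoidOn X) (S : Type w) where
  pt : S
  act : X → S → S
  act_zero : ∀ s, act B.zero s = s
  act_infty : ∀ s, act B.infty s = pt
  act_pt : ∀ n, act n pt = pt
  act_add : ∀ n m s, act (B.add n m) s = act n (act m s)

section NSet

variable {X : Type u} {S : Type w} {B : BinoidOn X}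

/-- One step of the connectedness relation on `S ∖ {p}`. -/
def NStep (σ : NSetOn B S) (s t : S) : Prop :=
  s ≠ σ.pt ∧ t ≠ σ.pt ∧ ∃ n, n ≠ B.infty ∧ (σ.act n s = t ∨ σ.act n t = s)

/-- The connectedness (equivalence) relation `∼_N` on `S ∖ {p}`. -/
def NConn (σ : NSetOn B S) : S → S → Prop := Relation.ReflTransGen (NStep σ)

/-- `N`-subsets of an `N`-set. -/
def IsNSubset (σ : NSetOn B S) (T : Set S) : Prop :=
  σ.pt ∈ T ∧ ∀ n : X, ∀ s ∈ T, σ.act n s ∈ T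

/-- `T` is a pointed union of two nontrivial `N`-subsets. -/
def IsReducibleSet (σ : NSetOn B S) (T : Set S) : Prop :=
  ∃ A A' : Set S, IsNSubset σ A ∧ IsNSubset σ A' ∧
    A ≠ {σ.pt} ∧ A' ≠ {σ.pt} ∧ A ∪ A' = T ∧ A ∩ A' = {σ.pt}

/-- An irreducible `N`-subset. -/
def IsIrreducibleSet (σ : NSetOn B S) (T : Set S) : Prop :=
  IsNSubset σ T ∧ T ≠ {σ.pt} ∧ ¬ IsReducibleSet σ T

end NSet

/-- The trivial binoid `{0, ∞}`, realized on `Bool` (`false = 0`, `true = ∞`). -/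
def trivB : BinoidOn Bool where
  add := or
  zero := false
  infty := true
  add_assoc := by decide
  add_comm := by decide
  zero_add := by decide
  infty_add := by decide

/-- The binoid `M^∞` obtained from a commutative monoid by adjoining `∞ = ⊤`. -/
def withTopBinoid (M : Type u) [AddCommMonoid M] : BinoidOn (WithTop M) where
  add := (· + ·)
  zero := 0
  infty := ⊤
  add_assoc := add_assoc
  add_comm := add_comm
  zero_add := zero_add
  infty_add := fun a => WithTop.top_add a


namespace BinoidOn

variable {X : Type u} (B : BinoidOn X)

lemma add_left_comm (a b c : X) : B.add a (B.add b c) = B.add b (B.add a c) := by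
  rw [← B.add_assoc, B.add_comm a b, B.add_assoc]

lemma smul_add (a : X) (k m : ℕ) : B.smul (k + m) a = B.add (B.smul k a) (B.smul m a) := by
  induction k with
  | zero => rw [Nat.zero_add, smul, B.zero_add]
  | succ k ih => rw [Nat.succ_add, smul, ih, smul, B.add_assoc]

lemma smul_mem_unitsSet {a : X} (ha : a ∈ B.unitsSet) (k : ℕ) : B.smul k a ∈ B.unitsSet := by
  obtain ⟨b, hb⟩ := ha
  refine ⟨B.smul k b, ?_⟩
  induction k with
  | zero => exact B.zero_add _
  | succ k ih =>
    rw [smul, smul, B.add_assoc, B.add_left_comm (B.smul k a), ih, ← B.add_assoc, hb,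
      B.zero_add]

lemma IsIdeal.infty_mem {B : BinoidOn X} {I : Set X} (hI : B.IsIdeal I) : B.infty ∈ I := by
  obtain ⟨⟨a, ha⟩, h⟩ := hI
  simpa only [B.add_comm a, B.infty_add] using h a ha B.infty

lemma IsIdeal.add_mem_left {B : BinoidOn X} {I : Set X} (hI : B.IsIdeal I) {a : X} (ha : a ∈ I)
    (x : X) : B.add x a ∈ I := by
  rw [B.add_comm]
  exact hI.2 a ha x

/-- Outside a primary ideal, a single element has only finitely many multiples. -/
lemma IsPrimary.finite_multiples_diff {B : BinoidOn X} {I : Set X} (hI : B.IsIdeal I)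
    (hP : B.IsPrimary I) (hU : B.unitsSet.Finite) (a : X) :
    (Set.range (fun k => B.smul k a) \ I).Finite := by
  by_cases ha : a ∈ B.unitsSet
  · refine hU.subset ?_
    rintro _ ⟨⟨k, rfl⟩, -⟩
    exact B.smul_mem_unitsSet ha k
  · have ha' : a ∈ B.radical I := hP.symm ▸ ha
    obtain ⟨m, -, hm⟩ := ha'
    refine ((Set.finite_Iio m).image fun k => B.smul k a).subset ?_
    rintro _ ⟨⟨k, rfl⟩, hk⟩
    refine ⟨k, Set.mem_Iio.2 (lt_of_not_ge fun hmk => hk ?_), rfl⟩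
    obtain ⟨c, rfl⟩ := Nat.exists_eq_add_of_le hmk
    simpa only [smul_add] using hI.2 _ hm (B.smul c a)

lemma exists_listSum_eq_smul_add [DecidableEq X] {g : X} {S : Finset X} (l : List X)
    (hl : ∀ a ∈ l, a ∈ insert g S) :
    ∃ k : ℕ, ∃ l' : List X, (∀ a ∈ l', a ∈ S) ∧
      B.listSum l = B.add (B.smul k g) (B.listSum l') := by
  induction l with
  | nil => exact ⟨0, [], by simp, (B.zero_add _).symm⟩
  | cons b l ih =>
    obtain ⟨k, l', hl', h⟩ := ih fun a ha => hl a (List.mem_cons_of_mem _ ha)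
    have h_cons : B.listSum (b :: l) = B.add b (B.listSum l) := rfl
    rcases Finset.mem_insert.1 (hl b List.mem_cons_self) with rfl | hb
    · exact ⟨k + 1, l', hl', by rw [h_cons, h, smul, B.add_assoc]⟩
    · refine ⟨k, b :: l', by simpa using ⟨hb, hl'⟩, ?_⟩
      rw [h_cons, h, B.add_left_comm]
      rfl

/-- Outside a primary ideal, finitely many elements have only finitely many sums. -/
lemma IsPrimary.finite_listSums_diff {B : BinoidOn X} {I : Set X} (hI : B.IsIdeal I)
    (hP : B.IsPrimary I) (hU : B.unitsSet.Finite) (S : Finset X) :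
    (B.listSum '' {l | ∀ a ∈ l, a ∈ S} \ I).Finite := by
  classical
  induction S using Finset.induction_on with
  | empty =>
    refine (Set.finite_singleton B.zero).subset ?_
    rintro _ ⟨⟨l, hl, rfl⟩, -⟩
    rw [List.eq_nil_iff_forall_not_mem.2 fun a ha => Finset.notMem_empty a (hl a ha)]
    rfl
  | insert g S _ ih =>
    refine ((hP.finite_multiples_diff hI hU g).image2 B.add ih).subset ?_
    rintro _ ⟨⟨l, hl, rfl⟩, hnot⟩
    obtain ⟨k, l', hl', h⟩ := B.exists_listSum_eq_smul_add l hl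
    rw [h] at hnot ⊢
    exact ⟨_, ⟨⟨k, rfl⟩, fun hk => hnot (hI.2 _ hk _)⟩,
      _, ⟨⟨l', hl', rfl⟩, fun hk => hnot (hI.add_mem_left hk _)⟩, rfl⟩

/-- A primary ideal of a finitely generated binoid with finitely many units is cofinite. -/
lemma IsPrimary.finite_compl {B : BinoidOn X} {I : Set X} (hP : B.IsPrimary I)
    (hI : B.IsIdeal I) (hfg : B.FG) (hU : B.unitsSet.Finite) : Iᶜ.Finite := by
  obtain ⟨G, hG⟩ := hfg
  refine (hP.finite_listSums_diff hI hU G).subset fun x hx => ?_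
  rcases hG x with rfl | ⟨l, hl, rfl⟩
  · exact absurd hI.infty_mem hx
  · exact ⟨⟨l, hl, rfl⟩, hx⟩

end BinoidOn

/-- Collapsing a nonempty cofinite set to a point leaves finitely many classes. -/
lemma finite_quotient_collapseSetoid {X : Type u} {A : Set X} (hA : A.Nonempty)
    (hfin : Aᶜ.Finite) : Finite (Quotient (collapseSetoid A)) := by
  obtain ⟨a, ha⟩ := hA
  refine Set.finite_univ_iff.1
    (((hfin.insert a).image (Quotient.mk (collapseSetoid A))).subset ?_)
  rintro ⟨x⟩ -
  by_cases hx : x ∈ A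
  · exact ⟨a, Set.mem_insert _ _, Quotient.sound (Or.inr ⟨ha, hx⟩)⟩
  · exact ⟨x, Set.mem_insert_of_mem _ hx, rfl⟩

/-- If `N` is a commutative, finitely generated, semipositive binoid
and `𝔫` is an `N₊`-primary ideal, then the Rees quotient `N/𝔫` is a finite set. -/
theorem stmt1 {X : Type} (B : BinoidOn X) (hfg : B.FG) (hsp : B.Semipositive)
    (n : Set X) (hn : B.IsIdeal n) (hpr : B.IsPrimary n) :
    Finite (Quotient (collapseSetoid n)) := by
  exact finite_quotient_collapseSetoid hn.1 (hpr.finite_compl hn hfg hsp.2)
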